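/- arXiv:1709.08877 — 3 statements merged into one kernel-verified Lean document; each statement's English description precedes it below -/
import Mathlib

section
/- Let (V,g,J) be a pseudo-hermitian vector space, A a hermitian endomorphism of V, and q a real polynomial. Then: (i) 𝖱_{q,A} maps u(g,J) into u(g,J), and for every X ∈ u(g,J) it satisfies [𝖱_{q,A}(X), A] = [X, q(A)]; (ii) if 𝖱 : u(g,J) → u(g,J) is any linear map satisfying [𝖱(X), A] = [X, q(A)] for all X ∈ u(g,J), then [𝖱(X) − 𝖱_{q,A}(X), A] = 0 for all X ∈ u(g,J), i.e. 𝖱 differs from 𝖱_{q,A} by an operator whose values commute with A. -/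
open Finset Polynomial

noncomputable section

/-- The Lie algebra `u(g,J)` of skew-hermitian endomorphisms: `g(Xx,y) = -g(x,Xy)`
and `X ∘ J = J ∘ X`. -/
def SkewHerm {V : Type*} [AddCommGroup V] [Module ℝ V]
    (g : V →ₗ[ℝ] V →ₗ[ℝ] ℝ) (J X : Module.End ℝ V) : Prop :=
  (∀ x y : V, g (X x) y = - g x (X y)) ∧ X * J = J * X

/-- The operator `𝖱_{q,A}` on endomorphisms:
`𝖱_{q,A}(X) = Σ_{k=1}^N a_k Σ_{r+s=k−1} (A^s X A^r − (1/2)·tr(J A^s X)·J A^r)`. -/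
def Rop {V : Type*} [AddCommGroup V] [Module ℝ V]
    (J : Module.End ℝ V) (q : Polynomial ℝ) (A X : Module.End ℝ V) : Module.End ℝ V :=
  ∑ k ∈ Finset.range (q.natDegree + 1), q.coeff k •
    ∑ r ∈ Finset.range k,
      (A ^ (k - 1 - r) * X * A ^ r
        - ((1 : ℝ) / 2 * LinearMap.trace ℝ V (J * A ^ (k - 1 - r) * X)) • (J * A ^ r))


section Helpers

variable {V : Type*} [AddCommGroup V] [Module ℝ V]

theorem SkewHerm.zero (g : V →ₗ[ℝ] V →ₗ[ℝ] ℝ) (J : Module.End ℝ V) : SkewHerm g J 0 := by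
  simp [SkewHerm]

theorem SkewHerm.add {g : V →ₗ[ℝ] V →ₗ[ℝ] ℝ} {J X Y : Module.End ℝ V}
    (hX : SkewHerm g J X) (hY : SkewHerm g J Y) : SkewHerm g J (X + Y) := by
  refine ⟨fun x y => ?_, by rw [add_mul, mul_add, hX.2, hY.2]⟩
  simp only [LinearMap.add_apply, map_add, hX.1, hY.1]
  ring

theorem SkewHerm.smul {g : V →ₗ[ℝ] V →ₗ[ℝ] ℝ} {J X : Module.End ℝ V} (c : ℝ)
    (hX : SkewHerm g J X) : SkewHerm g J (c • X) := by
  refine ⟨fun x y => ?_, by rw [smul_mul_assoc, mul_smul_comm, hX.2]⟩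
  simp only [LinearMap.smul_apply, map_smul, hX.1, smul_neg]

theorem SkewHerm.sub {g : V →ₗ[ℝ] V →ₗ[ℝ] ℝ} {J X Y : Module.End ℝ V}
    (hX : SkewHerm g J X) (hY : SkewHerm g J Y) : SkewHerm g J (X - Y) := by
  simpa [sub_eq_add_neg] using hX.add (hY.smul (-1))

theorem SkewHerm.sum {ι : Type*} {g : V →ₗ[ℝ] V →ₗ[ℝ] ℝ} {J : Module.End ℝ V} {s : Finset ι}
    {f : ι → Module.End ℝ V} (h : ∀ i ∈ s, SkewHerm g J (f i)) :
    SkewHerm g J (∑ i ∈ s, f i) :=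
  Finset.sum_induction f (SkewHerm g J) (fun _ _ => SkewHerm.add) (SkewHerm.zero g J) h

theorem pow_selfAdjoint {g : V →ₗ[ℝ] V →ₗ[ℝ] ℝ} {A : Module.End ℝ V}
    (hA : ∀ x y, g (A x) y = g x (A y)) (n : ℕ) (x y : V) :
    g ((A ^ n) x) y = g x ((A ^ n) y) := by
  induction n generalizing x y with
  | zero => simp
  | succ n ih => rw [pow_succ, Module.End.mul_apply, ih, hA, ← Module.End.mul_apply, ← pow_succ',
      pow_succ]

theorem skewHerm_mul_pow {g : V →ₗ[ℝ] V →ₗ[ℝ] ℝ} {J A : Module.End ℝ V}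
    (hJ2 : J * J = -1) (hJg : ∀ x y, g (J x) (J y) = g x y)
    (hA : ∀ x y, g (A x) y = g x (A y)) (hAJ : Commute A J) (n : ℕ) :
    SkewHerm g J (J * A ^ n) := by
  refine ⟨fun x y => ?_, by rw [mul_assoc, (hAJ.pow_left n).eq]⟩
  have hJJ (z : V) : J (J z) = -z := by
    simpa using LinearMap.congr_fun hJ2 z
  have hJskew (u v : V) : g (J u) v = -g u (J v) := by
    rw [← hJg u, hJJ, map_neg, neg_neg]
  rw [Module.End.mul_apply, hJskew, pow_selfAdjoint hA, ← Module.End.mul_apply,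
    (hAJ.pow_left n).eq]

theorem skewHerm_sum_pow_mul_mul_pow {g : V →ₗ[ℝ] V →ₗ[ℝ] ℝ} {J A X : Module.End ℝ V}
    (hA : ∀ x y, g (A x) y = g x (A y)) (hAJ : Commute A J) (hX : SkewHerm g J X) (k : ℕ) :
    SkewHerm g J (∑ r ∈ Finset.range k, A ^ (k - 1 - r) * X * A ^ r) := by
  constructor
  · intro x y
    simp only [LinearMap.sum_apply, map_sum, ← Finset.sum_neg_distrib]
    rw [← Finset.sum_range_reflect _ k]
    refine Finset.sum_congr rfl fun r hr => ?_
    have hr' : k - 1 - (k - 1 - r) = r := by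
      have := Finset.mem_range.mp hr
      omega
    simp only [hr', Module.End.mul_apply, pow_selfAdjoint hA, hX.1]
  · have hXJ : Commute X J := hX.2
    exact (Commute.sum_left _ _ _ fun r _ =>
      ((hAJ.pow_left _).mul_left hXJ).mul_left (hAJ.pow_left r)).eq

theorem sum_pow_mul_mul_pow_commutator {R : Type*} [Ring R] (A X : R) (k : ℕ) :
    (∑ r ∈ Finset.range k, A ^ (k - 1 - r) * X * A ^ r) * A
      - A * ∑ r ∈ Finset.range k, A ^ (k - 1 - r) * X * A ^ r = X * A ^ k - A ^ k * X := by
  have h := Finset.sum_range_sub (fun r => A ^ (k - r) * X * A ^ r) k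
  simp only [Nat.sub_self, Nat.sub_zero, pow_zero, one_mul, mul_one] at h
  rw [← h, Finset.sum_mul, Finset.mul_sum, ← Finset.sum_sub_distrib]
  refine Finset.sum_congr rfl fun r hr => ?_
  have hr := Finset.mem_range.mp hr
  rw [show k - (r + 1) = k - 1 - r by omega, show k - r = k - 1 - r + 1 by omega, pow_succ A r,
    pow_succ' A (k - 1 - r)]
  simp only [mul_assoc]

theorem skewHerm_Rop {g : V →ₗ[ℝ] V →ₗ[ℝ] ℝ} {J A X : Module.End ℝ V}
    (hJ2 : J * J = -1) (hJg : ∀ x y, g (J x) (J y) = g x y)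
    (hA : ∀ x y, g (A x) y = g x (A y)) (hAJ : Commute A J) (q : Polynomial ℝ)
    (hX : SkewHerm g J X) : SkewHerm g J (Rop J q A X) := by
  refine SkewHerm.sum fun k _ => SkewHerm.smul _ ?_
  rw [Finset.sum_sub_distrib]
  exact (skewHerm_sum_pow_mul_mul_pow hA hAJ hX k).sub
    (SkewHerm.sum fun r _ => (skewHerm_mul_pow hJ2 hJg hA hAJ r).smul _)

theorem Rop_commutator {J A : Module.End ℝ V} (hAJ : Commute A J) (q : Polynomial ℝ)
    (X : Module.End ℝ V) :
    Rop J q A X * A - A * Rop J q A X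
      = X * Polynomial.aeval A q - Polynomial.aeval A q * X := by
  rw [Rop, Polynomial.aeval_eq_sum_range]
  simp only [Finset.sum_mul, Finset.mul_sum, ← Finset.sum_sub_distrib, smul_mul_assoc,
    mul_smul_comm, ← smul_sub]
  refine Finset.sum_congr rfl fun k _ => ?_
  rw [← sum_pow_mul_mul_pow_commutator, Finset.sum_mul, Finset.mul_sum,
    ← Finset.sum_sub_distrib]
  congr 1
  refine Finset.sum_congr rfl fun r _ => ?_
  have hc : J * A ^ r * A = A * (J * A ^ r) :=
    (hAJ.mul_right (Commute.self_pow A r)).eq.symm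
  rw [sub_mul, mul_sub, smul_mul_assoc, mul_smul_comm, hc]
  abel

end Helpers

/-- (i) `𝖱_{q,A}` maps `u(g,J)` into `u(g,J)` and satisfies `[𝖱_{q,A}(X), A] = [X, q(A)]`;
(ii) any linear map `𝖱 : u(g,J) → u(g,J)` with `[𝖱(X), A] = [X, q(A)]` differs from
`𝖱_{q,A}` by an operator whose values commute with `A`. -/
theorem stmt4
    (V : Type*) [AddCommGroup V] [Module ℝ V] [FiniteDimensional ℝ V]
    (g : V →ₗ[ℝ] V →ₗ[ℝ] ℝ)
    (hgsymm : ∀ x y : V, g x y = g y x)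
    (hgnd : ∀ x : V, (∀ y : V, g x y = 0) → x = 0)
    (J : Module.End ℝ V)
    (hJ2 : J * J = -1)
    (hJg : ∀ x y : V, g (J x) (J y) = g x y)
    (A : Module.End ℝ V)
    (hAg : ∀ x y : V, g (A x) y = g x (A y))
    (hAJ : A * J = J * A)
    (q : Polynomial ℝ) :
    (∀ X : Module.End ℝ V, SkewHerm g J X →
      SkewHerm g J (Rop J q A X) ∧
        Rop J q A X * A - A * Rop J q A X
          = X * Polynomial.aeval A q - Polynomial.aeval A q * X)
    ∧ ∀ R : Module.End ℝ V →ₗ[ℝ] Module.End ℝ V,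
        (∀ X : Module.End ℝ V, SkewHerm g J X → SkewHerm g J (R X)) →
        (∀ X : Module.End ℝ V, SkewHerm g J X →
          R X * A - A * R X = X * Polynomial.aeval A q - Polynomial.aeval A q * X) →
        ∀ X : Module.End ℝ V, SkewHerm g J X →
          (R X - Rop J q A X) * A - A * (R X - Rop J q A X) = 0 := by
  have hcomm : Commute A J := hAJ
  refine ⟨fun X hX => ⟨skewHerm_Rop hJ2 hJg hAg hcomm q hX, Rop_commutator hcomm q X⟩,
    fun R _ hR X hX => ?_⟩
  rw [sub_mul, mul_sub, sub_sub_sub_comm, hR X hX, Rop_commutator hcomm q X, sub_self]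
end
end

section
/- Let (V,g,J) be a pseudo-hermitian vector space and let A, B be hermitian endomorphisms of V. Then the Ricci tensor of R_{A,B} is given by Ric(R_{A,B})(x,y) = g(x, [tr(A)·B + tr(B)·A + 2·(A∘B + B∘A)] y) for all x,y ∈ V. -/
open Finset Polynomial

noncomputable section

/-- Kulkarni–Nomizu product of two bilinear forms (as 4-tensor):
`(P⊘Q)(x,y,u,v) = P(x,u)Q(y,v) − P(x,v)Q(y,u) + Q(x,u)P(y,v) − Q(x,v)P(y,u)`. -/
def KN4 {V : Type*} [AddCommGroup V] [Module ℝ V] (P Q : V → V → ℝ) (x y u v : V) : ℝ :=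
  P x u * Q y v - P x v * Q y u + Q x u * P y v - Q x v * P y u

/-- Symmetric product `(P⊙Q)(x,y,u,v) = P(x,y)Q(u,v) + Q(x,y)P(u,v)`. -/
def SP4 {V : Type*} [AddCommGroup V] [Module ℝ V] (P Q : V → V → ℝ) (x y u v : V) : ℝ :=
  P x y * Q u v + Q x y * P u v

/-- `R_{A,B} = gA⊘gB + ωA⊘ωB + 2·ωA⊙ωB`, where `gA = g(A·,·)` and `ωA = ω(A·,·)`
with `ω(x,y) = g(Jx,y)`. -/
def RAB {V : Type*} [AddCommGroup V] [Module ℝ V]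
    (g : V →ₗ[ℝ] V →ₗ[ℝ] ℝ) (J A B : Module.End ℝ V) (x y u v : V) : ℝ :=
  KN4 (fun a b => g (A a) b) (fun a b => g (B a) b) x y u v
    + KN4 (fun a b => g (J (A a)) b) (fun a b => g (J (B a)) b) x y u v
    + 2 * SP4 (fun a b => g (J (A a)) b) (fun a b => g (J (B a)) b) x y u v

/-- An endomorphism that is skew for a nondegenerate bilinear form has trace zero. -/
theorem trace_eq_zero_of_skew {V : Type*} [AddCommGroup V] [Module ℝ V] [FiniteDimensional ℝ V]
    (g : V →ₗ[ℝ] V →ₗ[ℝ] ℝ) (hgnd : ∀ x : V, (∀ y : V, g x y = 0) → x = 0)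
    (T : Module.End ℝ V) (hT : ∀ x y : V, g (T x) y = -g x (T y)) :
    LinearMap.trace ℝ V T = 0 := by
  have hinj : Function.Injective g := by
    rw [injective_iff_map_eq_zero]
    exact fun x hx => hgnd x fun y => by simp [hx]
  let e : V ≃ₗ[ℝ] Module.Dual ℝ V :=
    LinearMap.linearEquivOfInjective g hinj Subspace.dual_finrank_eq.symm
  have he : ∀ x y, e x y = g x y := fun _ _ => rfl
  have hconj : e.conj (-T) = Module.Dual.transpose (R := ℝ) T := by
    ext f v
    obtain ⟨x, rfl⟩ := e.surjective f
    simp [LinearEquiv.conj_apply, Module.Dual.transpose_apply, he, hT]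
  have htr := LinearMap.trace_conj' (-T) e
  rw [hconj, LinearMap.trace_transpose', map_neg] at htr
  linarith

/-- `Ric(R_{A,B})(x,y) = g(x, [tr(A)·B + tr(B)·A + 2(A∘B + B∘A)] y)`. -/
theorem stmt6
    (V : Type*) [AddCommGroup V] [Module ℝ V] [FiniteDimensional ℝ V]
    (g : V →ₗ[ℝ] V →ₗ[ℝ] ℝ)
    (hgsymm : ∀ x y : V, g x y = g y x)
    (hgnd : ∀ x : V, (∀ y : V, g x y = 0) → x = 0)
    (J : Module.End ℝ V)
    (hJ2 : J * J = -1)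
    (hJg : ∀ x y : V, g (J x) (J y) = g x y)
    (A : Module.End ℝ V)
    (hAg : ∀ x y : V, g (A x) y = g x (A y))
    (hAJ : A * J = J * A)
    (B : Module.End ℝ V)
    (hBg : ∀ x y : V, g (B x) y = g x (B y))
    (hBJ : B * J = J * B)
    (Rend : V → V → V → V)
    (hRend : ∀ x y u v : V, g x (Rend u v y) = RAB g J A B x y u v) :
    ∀ (x y : V) (L : V →ₗ[ℝ] V), (∀ z : V, L z = Rend z x y) →
      LinearMap.trace ℝ V L =
        g x ((LinearMap.trace ℝ V A • B + LinearMap.trace ℝ V B • A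
          + (2 : ℝ) • (A * B + B * A)) y) := by
  intro x y L hL
  have hJsq : ∀ z, J (J z) = -z := fun z => by simpa using LinearMap.congr_fun hJ2 z
  have hAJ' : ∀ z, A (J z) = J (A z) := LinearMap.congr_fun hAJ
  have hBJ' : ∀ z, B (J z) = J (B z) := LinearMap.congr_fun hBJ
  have hJskew : ∀ a b, g (J a) b = -g a (J b) := fun a b => by
    rw [← hJg a (J b), hJsq, map_neg, neg_neg]
  have trJA : LinearMap.trace ℝ V (J * A) = 0 :=
    trace_eq_zero_of_skew g hgnd _ fun a b => by simp [hJskew, hAg, hAJ']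
  have trJB : LinearMap.trace ℝ V (J * B) = 0 :=
    trace_eq_zero_of_skew g hgnd _ fun a b => by simp [hJskew, hBg, hBJ']
  have hLeq : L = g (B y) x • A - (g (B y)).smulRight (A x)
      + g (A y) x • B - (g (A y)).smulRight (B x)
      - g (J (B y)) x • (J * A) + (g (J (B y))).smulRight (J (A x))
      - g (J (A y)) x • (J * B) + (g (J (A y))).smulRight (J (B x))
      + (2 : ℝ) • (g (B (J x))).smulRight (J (A y))
      + (2 : ℝ) • (g (A (J x))).smulRight (J (B y)) := by
    ext z
    rw [← sub_eq_zero]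
    refine hgnd _ fun w => ?_
    rw [hgsymm, map_sub, hL, hRend]
    have h₁ : ∀ z, g (B (J x)) z = -g (J (B z)) x := fun z => by
      rw [hgsymm, ← hBg, hJskew, neg_neg]
    have h₂ : ∀ z, g (A (J x)) z = -g (J (A z)) x := fun z => by
      rw [hgsymm, ← hAg, hJskew, neg_neg]
    have h₃ : ∀ a b, g (J (A a)) b = -g a (J (A b)) := fun a b => by
      rw [hJskew, hAg, hAJ']
    have h₄ : ∀ a b, g (J (B a)) b = -g a (J (B b)) := fun a b => by
      rw [hJskew, hBg, hBJ']
    simp only [RAB, KN4, SP4, LinearMap.add_apply, LinearMap.sub_apply, LinearMap.smul_apply,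
      LinearMap.smulRight_apply, Module.End.mul_apply, map_add, map_sub, map_smul, smul_eq_mul,
      h₁, h₂, h₃ w, h₄ w, hAg w, hBg w]
    ring
  rw [hLeq]
  simp only [map_add, map_sub, map_smul, LinearMap.trace_smulRight, trJA, trJB, smul_eq_mul,
    LinearMap.add_apply, LinearMap.smul_apply, Module.End.mul_apply, hJg, hAJ', hBJ']
  rw [hgsymm x, hgsymm x, ← hAg x, ← hBg x, hgsymm (A x), hgsymm (B x)]
  ring
end
end

section
/- Let (V,g,J) be a pseudo-hermitian vector space and let A, B be hermitian endomorphisms of V. Then R_{A,B} is a Kähler algebraic curvature tensor: it satisfies the symmetries (K1) R(x,y,u,v) = −R(y,x,u,v) = −R(x,y,v,u), (K2) R(x,y,u,v) = R(u,v,x,y), (K3) R(x,y,u,v) + R(x,v,y,u) + R(x,u,v,y) = 0, and (K4) R(x,y,u,v) = R(Jx,Jy,u,v) = R(x,y,Ju,Jv), for all x,y,u,v ∈ V. -/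
open Finset Polynomial

noncomputable section

section Hermitian

variable {V : Type*} [AddCommGroup V] [Module ℝ V] {g : V →ₗ[ℝ] V →ₗ[ℝ] ℝ}
  {J A : Module.End ℝ V}

/-- A `g`-orthogonal complex structure is `g`-skew. -/
theorem apply_complexStructure_right (hJ2 : J * J = -1)
    (hJg : ∀ x y : V, g (J x) (J y) = g x y) (x y : V) : g x (J y) = -g (J x) y := by
  have hJJ : J (J y) = -y := by simpa using LinearMap.congr_fun hJ2 y
  have h := hJg x (J y)
  rw [hJJ, map_neg] at h
  exact h.symm

/-- The form `g(A·,·)` of a self-adjoint `A` is symmetric. -/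
theorem selfAdjoint_form_symm (hgsymm : ∀ x y : V, g x y = g y x)
    (hAg : ∀ x y : V, g (A x) y = g x (A y)) (x y : V) : g (A x) y = g (A y) x := by
  rw [hAg, hgsymm]

/-- The form `ω(A·,·)` of a hermitian `A` is alternating. -/
theorem hermitian_form_skew (hgsymm : ∀ x y : V, g x y = g y x) (hJ2 : J * J = -1)
    (hJg : ∀ x y : V, g (J x) (J y) = g x y)
    (hAg : ∀ x y : V, g (A x) y = g x (A y)) (hAJ : A * J = J * A) (x y : V) :
    g (J (A x)) y = -g (J (A y)) x := by
  have hc : A (J x) = J (A x) := LinearMap.congr_fun hAJ x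
  rw [← hc, hAg, hgsymm, apply_complexStructure_right hJ2 hJg]

end Hermitian

/-- `R_{A,B}` is a Kähler algebraic curvature tensor: it satisfies the symmetries
(K1)–(K4). -/
theorem stmt8
    (V : Type*) [AddCommGroup V] [Module ℝ V] [FiniteDimensional ℝ V]
    (g : V →ₗ[ℝ] V →ₗ[ℝ] ℝ)
    (hgsymm : ∀ x y : V, g x y = g y x)
    (hgnd : ∀ x : V, (∀ y : V, g x y = 0) → x = 0)
    (J : Module.End ℝ V)
    (hJ2 : J * J = -1)
    (hJg : ∀ x y : V, g (J x) (J y) = g x y)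
    (A : Module.End ℝ V)
    (hAg : ∀ x y : V, g (A x) y = g x (A y))
    (hAJ : A * J = J * A)
    (B : Module.End ℝ V)
    (hBg : ∀ x y : V, g (B x) y = g x (B y))
    (hBJ : B * J = J * B) :
    ∀ x y u v : V,
      RAB g J A B x y u v = -RAB g J A B y x u v ∧
      RAB g J A B x y u v = -RAB g J A B x y v u ∧
      RAB g J A B x y u v = RAB g J A B u v x y ∧
      RAB g J A B x y u v + RAB g J A B x v y u + RAB g J A B x u v y = 0 ∧
      RAB g J A B x y u v = RAB g J A B (J x) (J y) u v ∧
      RAB g J A B x y u v = RAB g J A B x y (J u) (J v) := by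
  have hJJ (x : V) : J (J x) = -x := by simpa using LinearMap.congr_fun hJ2 x
  have hAc (x : V) : A (J x) = J (A x) := LinearMap.congr_fun hAJ x
  have hBc (x : V) : B (J x) = J (B x) := LinearMap.congr_fun hBJ x
  have hJr := apply_complexStructure_right hJ2 hJg
  have hAs := selfAdjoint_form_symm hgsymm hAg
  have hBs := selfAdjoint_form_symm hgsymm hBg
  have hAw := hermitian_form_skew hgsymm hJ2 hJg hAg hAJ
  have hBw := hermitian_form_skew hgsymm hJ2 hJg hBg hBJ
  intro x y u v
  simp only [RAB, KN4, SP4]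
  refine ⟨?_, ?_, ?_, ?_, ?_, ?_⟩
  · rw [hAw y x, hBw y x]
    ring
  · rw [hAw v u, hBw v u]
    ring
  · rw [hAs u x, hAs u y, hAs v x, hAs v y, hBs u x, hBs u y, hBs v x, hBs v y,
      hAw u x, hAw u y, hAw v x, hAw v y, hBw u x, hBw u y, hBw v x, hBw v y]
    ring
  · rw [hAs v y, hAs v u, hAs u y, hBs v y, hBs v u, hBs u y,
      hAw v y, hAw v u, hAw u y, hBw v y, hBw v u, hBw u y]
    ring
  · simp only [hAc, hBc, hJJ, hJr, map_neg, LinearMap.neg_apply]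
    ring
  · simp only [hAc, hBc, hJJ, hJr, map_neg, LinearMap.neg_apply]
    ring
end
end
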